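/- arXiv:2601.15270 — 3 statements merged into one kernel-verified Lean document; each statement's English description precedes it below -/
import Mathlib

section
/- Let p be a prime and let A be a reduced Noetherian F-finite ring of characteristic p that is quasi-F-split. Then A is closed under p-th roots in its total ring of fractions: for every element b of the total ring of fractions K of A (the localization of A at its set of non-zerodivisors) with b^p ∈ A, one has b ∈ A. (In particular, A is weakly normal.) -/
/-!
# Statement 2

Let `p` be a prime and `A` a reduced Noetherian `F`-finite ring of characteristic `p` which is
quasi-`F`-split.  Then `A` is closed under `p`-th roots in its total ring of fractions: for every
`b` in the total ring of fractions `K` of `A` with `b ^ p ∈ A`, one has `b ∈ A`.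
-/

open WittVector Function

noncomputable section

namespace QFS

variable (p : ℕ) [hp : Fact p.Prime] (A : Type) [CommRing A]

/-- vanishing of low coefficients of an iterated Verschiebung -/
theorem iterate_verschiebung_coeff_lt (y : WittVector p A) :
    ∀ (m i : ℕ), i < m → (verschiebung^[m] y).coeff i = 0 := by
  intro m
  induction m with
  | zero => intro i hi; omega
  | succ m ih =>
    intro i hi
    rw [Function.iterate_succ_apply']
    match i with
    | 0 => exact verschiebung_coeff_zero _
    | Nat.succ j =>
      rw [verschiebung_coeff_succ]
      exact ih j (by omega)

/-- The constant coefficient map `R^k : W_{k+1}(A) → A` (the `k`-fold restriction). -/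
def wittRes (k : ℕ) : TruncatedWittVector p (k + 1) A →+* A :=
  (RingHom.liftOfSurjective (WittVector.truncate (p := p) (R := A) (k + 1))
    (WittVector.truncate_surjective p (k + 1) A))
    ⟨WittVector.constantCoeff, by
      intro x hx
      rw [WittVector.mem_ker_truncate] at hx
      simp only [RingHom.mem_ker, WittVector.constantCoeff_apply]
      exact hx 0 (by omega)⟩

theorem wittRes_truncate (k : ℕ) (x : WittVector p A) :
    wittRes p A k (WittVector.truncate (k + 1) x) = x.coeff 0 :=
  RingHom.liftOfRightInverse_comp_apply _ _ _ _ x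

variable [CharP A p]

/-- The Witt vector Frobenius on `W_n(A)` for a ring `A` of characteristic `p`
(the coefficientwise `p`-th power map). -/
def wittFrobC (n : ℕ) : TruncatedWittVector p n A →+* TruncatedWittVector p n A :=
  (RingHom.liftOfSurjective (WittVector.truncate (p := p) (R := A) n)
    (WittVector.truncate_surjective p n A))
    ⟨(WittVector.truncate n).comp (frobenius (p := p) (R := A)), by
      intro x hx
      rw [WittVector.mem_ker_truncate] at hx
      simp only [RingHom.mem_ker, RingHom.comp_apply]
      rw [← RingHom.mem_ker, WittVector.mem_ker_truncate]
      intro i hi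
      rw [coeff_frobenius_charP, hx i hi, zero_pow hp.out.ne_zero]⟩

/-- The Frobenius on truncated Witt vectors is the coefficientwise `p`-th power map. -/
theorem wittFrobC_truncate (n : ℕ) (x : WittVector p A) (i : Fin n) :
    (wittFrobC p A n (WittVector.truncate n x)).coeff i = x.coeff i ^ p := by
  have : wittFrobC p A n (WittVector.truncate n x)
      = WittVector.truncate n (frobenius x) :=
    RingHom.liftOfRightInverse_comp_apply _ _ _ _ x
  rw [this, WittVector.coeff_truncate, coeff_frobenius_charP]

/-- The additive map `x ↦ (R^k x, -F x)` whose cokernel is the pushout `Q_{A,k+1}`. -/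
def psiC (k : ℕ) :
    TruncatedWittVector p (k + 1) A →+ A × TruncatedWittVector p (k + 1) A :=
  AddMonoidHom.mk' (fun x => (wittRes p A k x, - wittFrobC p A (k + 1) x)) (by
    intro a b
    simp [Prod.ext_iff, map_add]
    abel)

/-- The pushout `Q_{A,k+1}` of `F : W_{k+1}(A) → F_*W_{k+1}(A)` and `R^k : W_{k+1}(A) → A`,
realized as the quotient of `A ⊕ F_*W_{k+1}(A)` by the graph relation. -/
def QC (k : ℕ) : Type :=
  (A × TruncatedWittVector p (k + 1) A) ⧸ (psiC p A k).range

instance (k : ℕ) : AddCommGroup (QC p A k) :=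
  QuotientAddGroup.Quotient.addCommGroup _

/-- Projection onto the pushout `Q_{A,k+1}`. -/
def mkC (k : ℕ) : A × TruncatedWittVector p (k + 1) A →+ QC p A k :=
  QuotientAddGroup.mk' _

/-- The pushout structure map `Φ_{A,k+1} : A → Q_{A,k+1}`. -/
def PhiC (k : ℕ) (a : A) : QC p A k :=
  mkC p A k (a, 0)

/-- The action of `W_{k+1}(A)` on representatives of elements of `Q_{A,k+1}`:
`A` is a `W_{k+1}(A)`-algebra via `R^k` and `F_*W_{k+1}(A)` is a `W_{k+1}(A)`-algebra via `F`. -/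
def wsmulC (k : ℕ) (x : TruncatedWittVector p (k + 1) A)
    (m : A × TruncatedWittVector p (k + 1) A) : A × TruncatedWittVector p (k + 1) A :=
  (wittRes p A k x * m.1, wittFrobC p A (k + 1) x * m.2)

/-- The `1`-fold Verschiebung `V : W_k(A) → W_{k+1}(A)`, the additive shift map. -/
def vshiftC (k : ℕ) (y : TruncatedWittVector p k A) : TruncatedWittVector p (k + 1) A :=
  TruncatedWittVector.mk p
    (fun i => if h' : 1 ≤ (i : ℕ) then y.coeff ⟨(i : ℕ) - 1, by have := i.isLt; omega⟩ else 0)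

/-- `A` is `n`-quasi-`F`-split for `n = k + 1` if the pushout structure map
`Φ_{A,n} : A → Q_{A,n}` admits an `A`-linear retraction; here a map `Q_{A,n} → A` is `A`-linear
iff it is additive and `W_n(A)`-semilinear with respect to `R^{n-1} : W_n(A) → A`.
`A` is quasi-`F`-split if it is `n`-quasi-`F`-split for some `n ≥ 1`. -/
def QuasiFSplit : Prop :=
  ∃ (k : ℕ) (s : QC p A k →+ A),
    (∀ (x : TruncatedWittVector p (k + 1) A) (m : A × TruncatedWittVector p (k + 1) A),
      s (mkC p A k (wsmulC p A k x m)) = wittRes p A k x * s (mkC p A k m)) ∧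
    (∀ a : A, s (PhiC p A k a) = a)

theorem wittFrobC_truncate_teichmuller (n : ℕ) (a : A) :
    wittFrobC p A n (WittVector.truncate n (teichmuller p a))
      = WittVector.truncate n (teichmuller p (a ^ p)) := by
  ext i
  rw [wittFrobC_truncate, WittVector.coeff_truncate]
  rcases Nat.eq_zero_or_pos (i : ℕ) with hi | hi
  · rw [hi, teichmuller_coeff_zero, teichmuller_coeff_zero]
  · rw [teichmuller_coeff_pos p a _ hi, teichmuller_coeff_pos p (a ^ p) _ hi,
      zero_pow hp.out.ne_zero]

theorem mkC_wittFrobC (k : ℕ) (x : TruncatedWittVector p (k + 1) A) :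
    mkC p A k (0, wittFrobC p A (k + 1) x) = PhiC p A k (wittRes p A k x) := by
  refine QuotientAddGroup.eq.mpr ⟨x, ?_⟩
  simp [psiC]

variable {p A} in
/-- In a quasi-`F`-split ring, divisibility of `p`-th powers implies divisibility. -/
theorem QuasiFSplit.dvd_of_pow_dvd_pow (h : QuasiFSplit p A) {a t : A} (hat : t ^ p ∣ a ^ p) :
    t ∣ a := by
  obtain ⟨k, s, hs, hs_Phi⟩ := h
  obtain ⟨c, hc⟩ := hat
  let τ (x : A) : TruncatedWittVector p (k + 1) A := WittVector.truncate (k + 1) (teichmuller p x)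
  have res_τ (x : A) : wittRes p A k (τ x) = x := by
    rw [wittRes_truncate, teichmuller_coeff_zero]
  have frob_τ : wittFrobC p A (k + 1) (τ a) = wittFrobC p A (k + 1) (τ t) * τ c := by
    simp only [τ, wittFrobC_truncate_teichmuller, hc, map_mul]
  refine ⟨s (mkC p A k (0, τ c)), ?_⟩
  calc a = s (mkC p A k (0, wittFrobC p A (k + 1) (τ a))) := by
        rw [mkC_wittFrobC, res_τ, hs_Phi]
    _ = s (mkC p A k (wsmulC p A k (τ t) (0, τ c))) := by
        rw [frob_τ, wsmulC, mul_zero]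
    _ = t * s (mkC p A k (0, τ c)) := by rw [hs, res_τ]

/-- A reduced Noetherian `F`-finite quasi-`F`-split ring `A` of characteristic
`p` is closed under `p`-th roots in its total ring of fractions; in particular `A` is weakly
normal. -/
theorem mem_range_of_pow_mem_of_quasiFSplit
    [IsReduced A] [IsNoetherianRing A] (hFf : (frobenius A p).Finite)
    (hQFS : QuasiFSplit p A)
    (K : Type) [CommRing K] [Algebra A K] [IsLocalization (nonZeroDivisors A) K]
    (b : K) (hb : b ^ p ∈ (algebraMap A K).range) :
    b ∈ (algebraMap A K).range := by
  obtain ⟨c, hc⟩ := hb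
  obtain ⟨a, t, rfl⟩ := IsLocalization.exists_mk'_eq (nonZeroDivisors A) b
  have hpow : (t : A) ^ p ∣ a ^ p := by
    refine ⟨c, IsLocalization.injective K le_rfl ?_⟩
    rw [map_mul, map_pow, map_pow, hc, ← mul_pow, IsLocalization.mk'_spec']
  obtain ⟨d, hd⟩ := hQFS.dvd_of_pow_dvd_pow hpow
  exact ⟨d, (IsLocalization.mk'_eq_iff_eq_mul.mpr (by rw [hd, map_mul, mul_comm])).symm⟩

end QFS
end
end

section
/- Let p be a prime, let A be a normal Noetherian domain that is p-torsion-free, and let n ≥ 1. Then the sequence 0 → F_*W_n(A) → F_*W_n(A) → Q_{A,n} → 0 is exact, where the first map is multiplication by p and the second is the canonical map to the pushout. Equivalently: multiplication by p on W_n(A) is injective, the canonical map q : F_*W_n(A) → Q_{A,n} (sending y to the class of (0, y)) is surjective, and the kernel of q equals p·W_n(A). In particular Q_{A,n} is annihilated by p, so the map Φ̃_{A,n} : A → Q_{A,n} factors through the quotient A/pA, inducing a map Φ_{A,n} : A/pA → Q_{A,n}. -/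
/-!
# Statement 3

Let `p` be a prime and `A` a normal Noetherian domain which is `p`-torsion-free, and let `n ≥ 1`.
Then `0 → F_*W_n(A) →(·p) F_*W_n(A) →(q) Q_{A,n} → 0` is exact: multiplication by `p` on
`W_n(A)` is injective, the canonical map `q : F_*W_n(A) → Q_{A,n}` is surjective, and the kernel
of `q` is `p·W_n(A)`.  In particular `Q_{A,n}` is annihilated by `p`, so `Φ̃_{A,n} : A → Q_{A,n}`
factors through `A/pA`.
-/

open WittVector Function

noncomputable section

namespace QFS

variable (p : ℕ) [hp : Fact p.Prime] (A : Type) [CommRing A]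

/-- The ring homomorphism `F : W_{n+1}(A) → W_n(A)` induced by the Witt vector Frobenius. -/
def wittFrob (n : ℕ) :
    TruncatedWittVector p (n + 1) A →+* TruncatedWittVector p n A :=
  (RingHom.liftOfSurjective (WittVector.truncate (p := p) (R := A) (n + 1))
    (WittVector.truncate_surjective p (n + 1) A))
    ⟨(WittVector.truncate n).comp (frobenius (p := p) (R := A)), by
      intro x hx
      rw [WittVector.mem_ker_truncate] at hx
      simp only [RingHom.mem_ker, RingHom.comp_apply]
      rw [← RingHom.mem_ker, WittVector.mem_ker_truncate]
      intro i hi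
      have hx' : x = verschiebung^[n + 1] (WittVector.mk p fun j => x.coeff (j + (n + 1))) := by
        apply WittVector.ext
        intro j
        rcases Nat.lt_or_ge j (n + 1) with h | h
        · rw [hx j h, iterate_verschiebung_coeff_lt p A _ _ _ h]
        · obtain ⟨l, rfl⟩ : ∃ l, j = l + (n + 1) := ⟨j - (n + 1), by omega⟩
          rw [iterate_verschiebung_coeff]
          rfl
      rw [hx', show (n + 1) = 1 + n by omega, Function.iterate_add_apply,
        Function.iterate_one, frobenius_verschiebung, iterate_verschiebung_mul_left]
      exact iterate_verschiebung_coeff_lt p A _ _ _ hi⟩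

theorem wittFrob_truncate (n : ℕ) (x : WittVector p A) :
    wittFrob p A n (WittVector.truncate (n + 1) x) = WittVector.truncate n (frobenius x) :=
  RingHom.liftOfRightInverse_comp_apply _ _ _ _ x

/-- The additive map `x ↦ (R^n x, -F x)` on `W_{n+1}(A)` whose cokernel is the pushout
`Q_{A,n}`. -/
def psiM (n : ℕ) :
    TruncatedWittVector p (n + 1) A →+ A × TruncatedWittVector p n A :=
  AddMonoidHom.mk' (fun x => (wittRes p A n x, - wittFrob p A n x)) (by
    intro a b
    simp [Prod.ext_iff, map_add]
    abel)

/-- The pushout `Q_{A,n}` of `F : W_{n+1}(A) → F_*W_n(A)` and `R^n : W_{n+1}(A) → A`,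
realized as the quotient of `A ⊕ F_*W_n(A)` by the graph relation. -/
def QM (n : ℕ) : Type :=
  (A × TruncatedWittVector p n A) ⧸ (psiM p A n).range

instance (n : ℕ) : AddCommGroup (QM p A n) :=
  QuotientAddGroup.Quotient.addCommGroup _

/-- Projection onto the pushout `Q_{A,n}`. -/
def mkM (n : ℕ) : A × TruncatedWittVector p n A →+ QM p A n :=
  QuotientAddGroup.mk' _

/-- The pushout structure map `Φ̃_{A,n} : A → Q_{A,n}`, `a ↦ class of (a, 0)`. -/
def PhiM (n : ℕ) (a : A) : QM p A n :=
  mkM p A n (a, 0)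

/-- The canonical map `q : F_*W_n(A) → Q_{A,n}`, `y ↦ class of (0, y)`. -/
def qM (n : ℕ) (y : TruncatedWittVector p n A) : QM p A n :=
  mkM p A n (0, y)

/-- The ghost component `w_i` is `p ^ i` times the `i`-th coefficient as soon as all the lower
coefficients vanish. -/
theorem ghostComponent_eq_of_coeff_eq_zero (x : WittVector p A) (i : ℕ)
    (h : ∀ j < i, x.coeff j = 0) :
    ghostComponent i x = (p : A) ^ i * x.coeff i := by
  rw [ghostComponent_apply, aeval_wittPolynomial, Finset.sum_range_succ,
    Finset.sum_eq_zero fun j hj => ?_]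
  · simp
  · rw [h j (Finset.mem_range.mp hj), zero_pow (pow_pos hp.out.pos _).ne', mul_zero]

/-- If `A` is `p`-torsion-free and the first `n` coefficients of `p * x` vanish, so do those
of `x`. -/
theorem coeff_eq_zero_of_natCast_mul (hptf : ∀ a : A, (p : A) * a = 0 → a = 0) (n : ℕ)
    (x : WittVector p A) (h : ∀ i < n, ((p : WittVector p A) * x).coeff i = 0) :
    ∀ i < n, x.coeff i = 0 := by
  have hpow : ∀ (k : ℕ) (a : A), (p : A) ^ k * a = 0 → a = 0 := by
    intro k
    induction k with
    | zero => simp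
    | succ k ih => exact fun a ha => ih a (hptf _ (by rw [← ha]; ring))
  intro i
  induction i using Nat.strong_induction_on with
  | _ i ih =>
    intro hi
    have hg := ghostComponent_eq_of_coeff_eq_zero p A _ i fun j hj => h j (hj.trans hi)
    rw [h i hi, mul_zero, map_mul, map_natCast,
      ghostComponent_eq_of_coeff_eq_zero p A x i fun j hj => ih j hj (hj.trans hi)] at hg
    exact hpow i _ (hptf _ hg)

theorem truncated_natCast_mul_injective (hptf : ∀ a : A, (p : A) * a = 0 → a = 0) (n : ℕ) :
    Function.Injective
      (fun y : TruncatedWittVector p n A => (p : TruncatedWittVector p n A) * y) := by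
  intro y z hyz
  obtain ⟨x, hx⟩ := WittVector.truncate_surjective p n A (y - z)
  have h0 : (p : WittVector p A) * x ∈ RingHom.ker (WittVector.truncate (p := p) (R := A) n) := by
    rw [RingHom.mem_ker, map_mul, map_natCast, hx, mul_sub, sub_eq_zero]
    exact hyz
  rw [WittVector.mem_ker_truncate] at h0
  rw [← sub_eq_zero, ← hx, ← RingHom.mem_ker, WittVector.mem_ker_truncate]
  exact coeff_eq_zero_of_natCast_mul p A hptf n x h0

theorem wittRes_surjective (n : ℕ) : Function.Surjective (wittRes p A n) := fun a =>
  ⟨WittVector.truncate (n + 1) (teichmuller p a), by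
    rw [wittRes_truncate, teichmuller_coeff_zero]⟩

theorem qM_surjective (n : ℕ) : Function.Surjective (qM p A n) := by
  intro c
  obtain ⟨⟨a, y⟩, rfl⟩ := QuotientAddGroup.mk'_surjective _ c
  obtain ⟨x, rfl⟩ := wittRes_surjective p A n a
  refine ⟨y + wittFrob p A n x, ?_⟩
  refine (QuotientAddGroup.eq (s := (psiM p A n).range)).mpr ⟨x, ?_⟩
  simp [psiM]

/-- The kernel of `R^n` is `V W_n(A)`, whose image under `F` is `p W_n(A)`. -/
theorem exists_wittFrob_eq_iff (n : ℕ) (y : TruncatedWittVector p n A) :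
    (∃ x, wittRes p A n x = 0 ∧ wittFrob p A n x = y) ↔
      ∃ z : TruncatedWittVector p n A, y = (p : TruncatedWittVector p n A) * z := by
  constructor
  · rintro ⟨x, hx, rfl⟩
    obtain ⟨w, rfl⟩ := WittVector.truncate_surjective p (n + 1) A x
    rw [wittRes_truncate] at hx
    have hw : verschiebung (w.shift 1) = w := by
      refine (WittVector.verschiebung_shift w 0 fun i hi => ?_).trans
        (WittVector.ext fun i => by rw [WittVector.shift_coeff, zero_add])
      obtain rfl : i = 0 := by omega
      exact hx
    refine ⟨WittVector.truncate n (w.shift 1), ?_⟩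
    rw [wittFrob_truncate, ← hw, frobenius_verschiebung, hw, map_mul, map_natCast, mul_comm]
  · rintro ⟨z, rfl⟩
    obtain ⟨w, rfl⟩ := WittVector.truncate_surjective p n A z
    refine ⟨WittVector.truncate (n + 1) (verschiebung w), ?_, ?_⟩
    · rw [wittRes_truncate, verschiebung_coeff_zero]
    · rw [wittFrob_truncate, frobenius_verschiebung, map_mul, map_natCast, mul_comm]

theorem qM_eq_zero_iff (n : ℕ) (y : TruncatedWittVector p n A) :
    qM p A n y = 0 ↔ ∃ z : TruncatedWittVector p n A, y = (p : TruncatedWittVector p n A) * z := by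
  rw [← exists_wittFrob_eq_iff]
  refine (QuotientAddGroup.eq_zero_iff (N := (psiM p A n).range) _).trans ?_
  constructor
  · rintro ⟨x, hx⟩
    obtain ⟨h₁, h₂⟩ := Prod.ext_iff.mp hx
    exact ⟨-x, by rw [map_neg, neg_eq_zero]; exact h₁, by rw [map_neg]; exact h₂⟩
  · rintro ⟨x, h₁, rfl⟩
    exact ⟨-x, by simp [psiM, h₁]⟩

theorem nsmul_QM_eq_zero (n : ℕ) (x : QM p A n) : p • x = 0 := by
  obtain ⟨y, rfl⟩ := qM_surjective p A n x
  have h : p • qM p A n y = qM p A n (p • y) := by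
    rw [qM, qM, ← map_nsmul, Prod.smul_mk, smul_zero]
  rw [h, qM_eq_zero_iff]
  exact ⟨y, nsmul_eq_mul p y⟩

/-- For a normal Noetherian domain `A` which is `p`-torsion-free and `n ≥ 1`,
the sequence `0 → F_*W_n(A) →(·p) F_*W_n(A) →(q) Q_{A,n} → 0` is exact; in particular `Q_{A,n}`
is annihilated by `p` and `Φ̃_{A,n}` factors through `A/pA`, inducing `Φ_{A,n} : A/pA → Q_{A,n}`.
-/
theorem exact_sequence_p_Q
    [IsDomain A] [IsIntegrallyClosed A] [IsNoetherianRing A]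
    (hptf : ∀ a : A, (p : A) * a = 0 → a = 0)
    (n : ℕ) (hn : 1 ≤ n) :
    Function.Injective
      (fun y : TruncatedWittVector p n A => (p : TruncatedWittVector p n A) * y) ∧
    Function.Surjective (qM p A n) ∧
    (∀ y : TruncatedWittVector p n A,
      qM p A n y = 0 ↔ ∃ z : TruncatedWittVector p n A, y = (p : TruncatedWittVector p n A) * z) ∧
    (∀ x : QM p A n, p • x = 0) ∧
    (∃ Phibar : A ⧸ Ideal.span {(p : A)} →+ QM p A n,
      ∀ a : A, Phibar (Ideal.Quotient.mk (Ideal.span {(p : A)}) a) = PhiM p A n a) := by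
  refine ⟨truncated_natCast_mul_injective p A hptf n, qM_surjective p A n, qM_eq_zero_iff p A n,
    nsmul_QM_eq_zero p A n, ?_⟩
  let f : A →+ QM p A n := (mkM p A n).comp (AddMonoidHom.inl A (TruncatedWittVector p n A))
  refine ⟨QuotientAddGroup.lift (Ideal.span {(p : A)}).toAddSubgroup f ?_, fun a => rfl⟩
  intro a ha
  obtain ⟨b, rfl⟩ := Ideal.mem_span_singleton'.mp ha
  rw [AddMonoidHom.mem_ker, mul_comm, ← nsmul_eq_mul, map_nsmul]
  exact nsmul_QM_eq_zero p A n _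

end QFS
end
end

section
/- Let p be a prime, let A be a normal Noetherian domain that is p-torsion-free, and let m, n ≥ 1. Then the Verschiebung and restriction maps of Witt vectors induce maps V^n : F^n_*Q_{A,m} → Q_{A,n+m} (induced by the n-fold Verschiebung V^n : W_m(A) → W_{n+m}(A) on the Frobenius-pushforward components) and R^m : Q_{A,n+m} → Q_{A,n} (induced by the identity on A and the m-fold restriction R^m : W_{n+m}(A) → W_n(A)), and the resulting sequence 0 → F^n_*Q_{A,m} → Q_{A,n+m} → Q_{A,n} → 0 is exact. -/
/-!
# Statement 4

Let `p` be a prime, `A` a normal Noetherian domain which is `p`-torsion-free, and `m, n ≥ 1`.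
The Verschiebung and restriction of Witt vectors induce maps
`V^n : F^n_*Q_{A,m} → Q_{A,n+m}` and `R^m : Q_{A,n+m} → Q_{A,n}`, and the sequence
`0 → F^n_*Q_{A,m} → Q_{A,n+m} → Q_{A,n} → 0` is exact.
-/

open WittVector Function

noncomputable section

namespace QFS

variable (p : ℕ) [hp : Fact p.Prime] (A : Type) [CommRing A]

/-- The `a`-fold Verschiebung `V^a : W_b(A) → W_c(A)` (`c = a + b`), the additive shift map
`(x_0, …, x_{b-1}) ↦ (0, …, 0, x_0, …, x_{b-1})`. -/
def vshift (a : ℕ) {b : ℕ} (c : ℕ) (h : c = a + b) (y : TruncatedWittVector p b A) :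
    TruncatedWittVector p c A :=
  TruncatedWittVector.mk p
    (fun i => if h' : a ≤ (i : ℕ) then y.coeff ⟨(i : ℕ) - a, by have := i.isLt; omega⟩ else 0)

variable {p A}

theorem truncate_eq_zero_iff (n : ℕ) (y : WittVector p A) :
    WittVector.truncate n y = 0 ↔ ∃ w, y = verschiebung^[n] w := by
  rw [← RingHom.mem_ker, WittVector.mem_ker_truncate]
  constructor
  · exact fun h => ⟨y.shift n, eq_iterate_verschiebung h⟩
  · rintro ⟨w, rfl⟩ i hi
    exact iterate_verschiebung_coeff_lt p A w n i hi

theorem iterate_verschiebung_injective (n : ℕ) :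
    Function.Injective (verschiebung^[n] : WittVector p A → WittVector p A) := by
  intro x y h
  ext i
  rw [← iterate_verschiebung_coeff x n i, ← iterate_verschiebung_coeff y n i, h]

/-- If `A` is `p`-torsion-free, then so is `W_n(A)`. -/
theorem coeff_eq_zero_of_nsmul (hptf : ∀ a : A, (p : A) * a = 0 → a = 0) {n : ℕ}
    {x : WittVector p A} (h : ∀ i < n, (p • x).coeff i = 0) : ∀ i < n, x.coeff i = 0 := by
  have hpow : ∀ (k : ℕ) (a : A), (p : A) ^ k * a = 0 → a = 0 := by
    intro k
    induction k with
    | zero => simp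
    | succ k ih =>
      intro a ha
      exact hptf a (ih _ (by rw [← ha]; ring))
  have hghost : ∀ i < n, ghostComponent i x = 0 := by
    intro i hi
    apply hptf
    rw [← nsmul_eq_mul, ← map_nsmul, ghostComponent_apply, aeval_wittPolynomial]
    refine Finset.sum_eq_zero fun j hj => ?_
    rw [h j (by have := Finset.mem_range.1 hj; omega), zero_pow, mul_zero]
    exact pow_ne_zero _ hp.out.ne_zero
  intro i
  induction i using Nat.strong_induction_on with
  | _ i ih =>
    intro hi
    have hg := hghost i hi
    rw [ghostComponent_apply, aeval_wittPolynomial, Finset.sum_range_succ,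
      Finset.sum_eq_zero, zero_add, Nat.sub_self, pow_zero, pow_one] at hg
    · exact hpow i _ hg
    · intro j hj
      have hj := Finset.mem_range.1 hj
      rw [ih j hj (hj.trans hi), zero_pow, mul_zero]
      exact pow_ne_zero _ hp.out.ne_zero

theorem mkM_eq_zero_iff (n : ℕ) (v : A × TruncatedWittVector p n A) :
    mkM p A n v = 0 ↔ ∃ x, psiM p A n x = v :=
  QuotientAddGroup.eq_zero_iff v

theorem psiM_truncate (n : ℕ) (x : WittVector p A) :
    psiM p A n (WittVector.truncate (n + 1) x) =
      (x.coeff 0, -WittVector.truncate n (frobenius x)) := by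
  rw [← wittRes_truncate p A n, ← wittFrob_truncate]
  rfl

variable (p A) in
/-- The surjection `W(A) → Q_{A,n}` with kernel `pW(A) + V^n W(A)`. -/
def wittToQM (n : ℕ) : WittVector p A →+ QM p A n :=
  (mkM p A n).comp
    ((AddMonoidHom.inr A (TruncatedWittVector p n A)).comp
      (WittVector.truncate n : WittVector p A →+* _).toAddMonoidHom)

theorem wittToQM_apply (n : ℕ) (y : WittVector p A) :
    wittToQM p A n y = mkM p A n (0, WittVector.truncate n y) := rfl

theorem wittToQM_eq_zero_iff (n : ℕ) (y : WittVector p A) :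
    wittToQM p A n y = 0 ↔ ∃ z w, y = p • z + verschiebung^[n] w := by
  rw [wittToQM_apply, mkM_eq_zero_iff]
  constructor
  · rintro ⟨x, hx⟩
    obtain ⟨x, rfl⟩ := WittVector.truncate_surjective p (n + 1) A x
    rw [psiM_truncate, Prod.mk.injEq] at hx
    obtain ⟨h0, h1⟩ := hx
    obtain ⟨x, rfl⟩ : ∃ z, x = verschiebung^[1] z :=
      ⟨x.shift 1, eq_iterate_verschiebung fun i hi => by rwa [Nat.lt_one_iff.1 hi]⟩
    obtain ⟨w, hw⟩ := (truncate_eq_zero_iff n (y + p • x)).1 (by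
      rw [map_add, ← h1, Function.iterate_one, frobenius_verschiebung, nsmul_eq_mul, mul_comm,
        neg_add_cancel])
    exact ⟨-x, w, by rw [← hw, smul_neg]; abel⟩
  · rintro ⟨z, w, rfl⟩
    refine ⟨WittVector.truncate (n + 1) (verschiebung (-z)), ?_⟩
    rw [psiM_truncate, verschiebung_coeff_zero, frobenius_verschiebung, map_add,
      (truncate_eq_zero_iff n _).2 ⟨w, rfl⟩, add_zero, ← map_neg, neg_mul, neg_neg,
      nsmul_eq_mul, mul_comm]

theorem wittToQM_surjective (n : ℕ) : Function.Surjective (wittToQM p A n) := by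
  intro q
  obtain ⟨⟨a, y⟩, rfl⟩ := QuotientAddGroup.mk'_surjective _ q
  obtain ⟨y, rfl⟩ := WittVector.truncate_surjective p n A y
  refine ⟨y + frobenius (teichmuller p a), ?_⟩
  change _ = mkM p A n _
  rw [wittToQM_apply, ← sub_eq_zero, ← map_sub, mkM_eq_zero_iff]
  refine ⟨WittVector.truncate (n + 1) (-teichmuller p a), ?_⟩
  rw [map_neg, map_neg, psiM_truncate, teichmuller_coeff_zero]
  simp

/-- The additive map `V^n` on `W(A)`. -/
def iterateVerschiebung (n : ℕ) : WittVector p A →+ WittVector p A :=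
  AddMonoidHom.mk' (verschiebung^[n]) (iterate_map_add verschiebung n)

/-- If `A` is `p`-torsion-free, then `V^n y ∈ pW(A) + V^{n+m}W(A)` iff
`y ∈ pW(A) + V^m W(A)`. -/
theorem wittToQM_iterate_verschiebung_eq_zero_iff (hptf : ∀ a : A, (p : A) * a = 0 → a = 0)
    (m n : ℕ) (y : WittVector p A) :
    wittToQM p A (n + m) (verschiebung^[n] y) = 0 ↔ wittToQM p A m y = 0 := by
  simp only [wittToQM_eq_zero_iff, Function.iterate_add_apply]
  constructor
  · rintro ⟨z, w, h⟩
    have hz : p • z = verschiebung^[n] (y - verschiebung^[m] w) := by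
      rw [iterate_map_sub, h, add_sub_cancel_right]
    obtain ⟨z, rfl⟩ : ∃ u, z = verschiebung^[n] u :=
      ⟨z.shift n, eq_iterate_verschiebung (coeff_eq_zero_of_nsmul hptf fun i hi => by
        rw [hz]; exact iterate_verschiebung_coeff_lt p A _ n i hi)⟩
    rw [← iterate_map_nsmul] at hz
    exact ⟨z, w, by rw [iterate_verschiebung_injective n hz, sub_add_cancel]⟩
  · rintro ⟨z, w, rfl⟩
    exact ⟨verschiebung^[n] z, w, by rw [iterate_map_add, iterate_map_nsmul]⟩

theorem vshift_truncate (m n : ℕ) (y : WittVector p A) :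
    vshift p A n (n + m) rfl (WittVector.truncate m y) =
      WittVector.truncate (n + m) (verschiebung^[n] y) := by
  ext i
  rw [vshift, TruncatedWittVector.coeff_mk, WittVector.coeff_truncate]
  split_ifs with h
  · rw [WittVector.coeff_truncate]
    conv_rhs => rw [← Nat.sub_add_cancel h, iterate_verschiebung_coeff]
  · exact (iterate_verschiebung_coeff_lt p A y n i (not_le.1 h)).symm

variable (p A) in
/-- The map `R^m : Q_{A,n+m} → Q_{A,n}` induced by restriction of Witt vectors. -/
def restrictQM (m n : ℕ) : QM p A (n + m) →+ QM p A n :=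
  QuotientAddGroup.map _ _
    ((AddMonoidHom.id A).prodMap
      (TruncatedWittVector.truncate (p := p) (R := A) (Nat.le_add_right n m)).toAddMonoidHom) (by
    rintro _ ⟨x, rfl⟩
    obtain ⟨x, rfl⟩ := WittVector.truncate_surjective p (n + m + 1) A x
    refine ⟨WittVector.truncate (n + 1) x, ?_⟩
    rw [psiM_truncate, psiM_truncate]
    simp [TruncatedWittVector.truncate_wittVector_truncate])

theorem restrictQM_wittToQM (m n : ℕ) (y : WittVector p A) :
    restrictQM p A m n (wittToQM p A (n + m) y) = wittToQM p A n y := by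
  rw [wittToQM_apply, wittToQM_apply,
    ← TruncatedWittVector.truncate_wittVector_truncate (Nat.le_add_right n m) y]
  rfl

variable (p A)

/-- For a normal Noetherian domain `A` which is `p`-torsion-free and
`m, n ≥ 1`, the `n`-fold Verschiebung and the `m`-fold restriction induce maps
`V^n : F^n_*Q_{A,m} → Q_{A,n+m}` (induced by `V^n : W_m(A) → W_{n+m}(A)` on the
Frobenius-pushforward components) and `R^m : Q_{A,n+m} → Q_{A,n}` (induced by the identity on
`A` and `R^m : W_{n+m}(A) → W_n(A)`), and the resulting sequence
`0 → F^n_*Q_{A,m} → Q_{A,n+m} → Q_{A,n} → 0` is exact. -/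
theorem exact_sequence_V_R
    [IsDomain A] [IsIntegrallyClosed A] [IsNoetherianRing A]
    (hptf : ∀ a : A, (p : A) * a = 0 → a = 0)
    (m n : ℕ) (hm : 1 ≤ m) (hn : 1 ≤ n) :
    ∃ (Vbar : QM p A m →+ QM p A (n + m)) (Rbar : QM p A (n + m) →+ QM p A n),
      (∀ y : TruncatedWittVector p m A,
        Vbar (qM p A m y) = qM p A (n + m) (vshift p A n (n + m) rfl y)) ∧
      (∀ (a : A) (y : TruncatedWittVector p (n + m) A),
        Rbar (mkM p A (n + m) (a, y)) =
          mkM p A n (a, TruncatedWittVector.truncate (Nat.le_add_right n m) y)) ∧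
      Function.Injective Vbar ∧
      (∀ x : QM p A (n + m), Rbar x = 0 ↔ x ∈ Set.range Vbar) ∧
      Function.Surjective Rbar := by
  have hker := wittToQM_iterate_verschiebung_eq_zero_iff hptf m n
  let g : WittVector p A →+ QM p A (n + m) := (wittToQM p A (n + m)).comp (iterateVerschiebung n)
  let Vbar : QM p A m →+ QM p A (n + m) :=
    (wittToQM p A m).liftOfSurjective (wittToQM_surjective m) ⟨g, fun y hy => (hker y).2 hy⟩
  have hV : ∀ y, Vbar (wittToQM p A m y) = wittToQM p A (n + m) (verschiebung^[n] y) :=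
    fun y => AddMonoidHom.liftOfRightInverse_comp_apply _ _ _ _ y
  refine ⟨Vbar, restrictQM p A m n, ?_, fun a y => rfl, ?_, ?_, ?_⟩
  · intro y
    obtain ⟨y, rfl⟩ := WittVector.truncate_surjective p m A y
    rw [vshift_truncate]
    exact hV y
  · rw [injective_iff_map_eq_zero]
    intro q hq
    obtain ⟨y, rfl⟩ := wittToQM_surjective m q
    rwa [hV, hker] at hq
  · intro q
    constructor
    · intro hq
      obtain ⟨y, rfl⟩ := wittToQM_surjective (n + m) q
      rw [restrictQM_wittToQM, wittToQM_eq_zero_iff] at hq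
      obtain ⟨z, w, rfl⟩ := hq
      refine ⟨wittToQM p A m w, ?_⟩
      rw [hV, map_add, (wittToQM_eq_zero_iff (n + m) (p • z)).2 ⟨z, 0, by
        rw [iterate_map_zero, add_zero]⟩, zero_add]
    · rintro ⟨q, rfl⟩
      obtain ⟨y, rfl⟩ := wittToQM_surjective m q
      rw [hV, restrictQM_wittToQM, wittToQM_eq_zero_iff]
      exact ⟨0, y, by rw [smul_zero, zero_add]⟩
  · intro q
    obtain ⟨y, rfl⟩ := wittToQM_surjective n q
    exact ⟨_, restrictQM_wittToQM m n y⟩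

end QFS
end
end
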